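/- For every real z ≥ 1, the trigamma function satisfies 1/z < ψ'(z) < 1/z + 1/(2z²) + 1/(6z³). -/

import Mathlib

/-- The trigamma function `ψ'(z)`, the second derivative of `log Γ`. -/
noncomputable def trigamma (z : ℝ) : ℝ :=
  deriv (deriv (fun y : ℝ => Real.log (Real.Gamma y))) z

open Filter Topology Set

/-- Telescoping series of an antitone sequence tending to zero. -/
theorem Antitone.hasSum_sub_succ {f : ℕ → ℝ} (hf : Antitone f) (h0 : Tendsto f atTop (𝓝 0)) :
    HasSum (fun n => f n - f (n + 1)) (f 0) := by
  rw [hasSum_iff_tendsto_nat_of_nonneg fun n => sub_nonneg.2 (hf n.le_succ)]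
  simp_rw [Finset.sum_range_sub']
  simpa using h0.const_sub (f 0)

theorem tendsto_one_div_mul_add_natCast_pow {c : ℝ} (hc : 0 < c) (x : ℝ) {m : ℕ} (hm : m ≠ 0) :
    Tendsto (fun n : ℕ => 1 / (c * (x + n) ^ m)) atTop (𝓝 0) := by
  have h : Tendsto (fun n : ℕ => c * (x + n) ^ m) atTop atTop :=
    Tendsto.const_mul_atTop hc ((tendsto_pow_atTop hm).comp
      (tendsto_atTop_add_const_left _ x tendsto_natCast_atTop_atTop))
  simp_rw [one_div]
  exact h.inv_tendsto_atTop

theorem hasSum_one_div_add_sub_one_div_add {x : ℝ} (hx : 0 < x) :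
    HasSum (fun n : ℕ => 1 / (x + n) - 1 / (x + n + 1)) (1 / x) := by
  have hanti : Antitone fun n : ℕ => 1 / (x + n) := fun a b hab => by
    dsimp only
    gcongr
  have h0 : Tendsto (fun n : ℕ => 1 / (x + n)) atTop (𝓝 0) := by
    simpa using tendsto_one_div_mul_add_natCast_pow one_pos x one_ne_zero
  simpa [add_assoc] using hanti.hasSum_sub_succ h0

theorem summable_one_div_add_natCast_sq {x : ℝ} (hx : 0 < x) :
    Summable fun n : ℕ => 1 / (x + n) ^ 2 := by
  have h := (summable_nat_add_iff 1).2 (Real.summable_one_div_nat_pow.2 one_lt_two)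
  rw [← summable_nat_add_iff 1]
  refine .of_nonneg_of_le (fun n => by positivity) (fun n => ?_) h
  push_cast
  exact one_div_le_one_div_of_le (by positivity) (pow_le_pow_left₀ (by positivity) (by linarith) 2)

theorem one_div_lt_tsum_one_div_add_sq {x : ℝ} (hx : 0 < x) :
    1 / x < ∑' n : ℕ, 1 / (x + n) ^ 2 := by
  have key (n : ℕ) : 1 / (x + n) - 1 / (x + n + 1) < 1 / (x + n) ^ 2 := by
    have hy : 0 < x + n := by positivity
    generalize x + n = y at hy
    rw [← sub_pos]
    have : 1 / y ^ 2 - (1 / y - 1 / (y + 1)) = 1 / (y ^ 2 * (y + 1)) := by field_simp; ring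
    rw [this]
    positivity
  exact hasSum_lt (fun n => (key n).le) (key 0) (hasSum_one_div_add_sub_one_div_add hx)
    (summable_one_div_add_natCast_sq hx).hasSum

theorem tsum_one_div_add_sq_lt {x : ℝ} (hx : 0 < x) :
    ∑' n : ℕ, 1 / (x + n) ^ 2 < 1 / x + 1 / (2 * x ^ 2) + 1 / (6 * x ^ 3) := by
  set F : ℕ → ℝ := fun n => 1 / (x + n) + 1 / (2 * (x + n) ^ 2) + 1 / (6 * (x + n) ^ 3) with hF
  have hanti : Antitone F := fun a b hab => by
    simp only [hF]
    gcongr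
  have h0 : Tendsto F atTop (𝓝 0) := by
    simpa [hF] using ((tendsto_one_div_mul_add_natCast_pow one_pos x one_ne_zero).add
      (tendsto_one_div_mul_add_natCast_pow two_pos x two_ne_zero)).add
      (tendsto_one_div_mul_add_natCast_pow (c := 6) (by norm_num) x three_ne_zero)
  have key (n : ℕ) : 1 / (x + n) ^ 2 < F n - F (n + 1) := by
    have hy : 0 < x + n := by positivity
    simp only [hF, Nat.cast_add, Nat.cast_one, ← add_assoc]
    generalize x + n = y at hy
    rw [← sub_pos]
    have : 1 / y + 1 / (2 * y ^ 2) + 1 / (6 * y ^ 3) -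
        (1 / (y + 1) + 1 / (2 * (y + 1) ^ 2) + 1 / (6 * (y + 1) ^ 3)) - 1 / y ^ 2 =
        1 / (6 * y ^ 3 * (y + 1) ^ 3) := by field_simp; ring
    rw [this]
    positivity
  simpa [hF] using hasSum_lt (fun n => (key n).le) (key 0)
    (summable_one_div_add_natCast_sq hx).hasSum (hanti.hasSum_sub_succ h0)

theorem Real.analyticAt_Gamma {x : ℝ} (hx : 0 < x) : AnalyticAt ℝ Real.Gamma x := by
  have hd : DifferentiableOn ℂ Complex.Gamma {s | 0 < s.re} := fun s hs =>
    (Complex.differentiableAt_Gamma s fun m h => by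
      have : (0 : ℝ) < -m := by simpa [h] using hs
      linarith [m.cast_nonneg (α := ℝ)]).differentiableWithinAt
  have ha := hd.analyticAt
    ((isOpen_lt continuous_const Complex.continuous_re).mem_nhds (by simpa using hx : _ < (x : ℂ).re))
  simpa [Complex.Gamma_ofReal] using ha.re_ofReal

theorem Real.analyticAt_log_Gamma {x : ℝ} (hx : 0 < x) :
    AnalyticAt ℝ (fun y => Real.log (Real.Gamma y)) x :=
  (Real.analyticAt_Gamma hx).log (Real.Gamma_pos_of_pos hx)

theorem Real.deriv_log_Gamma_add_one {x : ℝ} (hx : 0 < x) :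
    deriv (fun y => Real.log (Real.Gamma y)) (x + 1) =
      deriv (fun y => Real.log (Real.Gamma y)) x + 1 / x := by
  have h : (fun y => Real.log (Real.Gamma (y + 1))) =ᶠ[𝓝 x]
      fun y => Real.log (Real.Gamma y) + Real.log y := by
    filter_upwards [lt_mem_nhds hx] with y hy
    rw [Real.Gamma_add_one hy.ne', Real.log_mul hy.ne' (Real.Gamma_pos_of_pos hy).ne', add_comm]
  rw [← deriv_comp_add_const (f := fun y => Real.log (Real.Gamma y)), h.deriv_eq,
    deriv_fun_add (Real.analyticAt_log_Gamma hx).differentiableAt (Real.differentiableAt_log hx.ne'),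
    Real.deriv_log, one_div]

theorem hasDerivAt_deriv_log_Gamma {x : ℝ} (hx : 0 < x) :
    HasDerivAt (deriv fun y => Real.log (Real.Gamma y)) (trigamma x) x :=
  (Real.analyticAt_log_Gamma hx).deriv.differentiableAt.hasDerivAt

theorem trigamma_eq_add_trigamma_add_one {x : ℝ} (hx : 0 < x) :
    trigamma x = 1 / x ^ 2 + trigamma (x + 1) := by
  have h : (fun y => deriv (fun y => Real.log (Real.Gamma y)) (y + 1)) =ᶠ[𝓝 x]
      fun y => deriv (fun y => Real.log (Real.Gamma y)) y + y⁻¹ := by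
    filter_upwards [lt_mem_nhds hx] with y hy
    rw [Real.deriv_log_Gamma_add_one hy, one_div]
  have h2 := ((hasDerivAt_deriv_log_Gamma hx).add (hasDerivAt_inv hx.ne')).congr_of_eventuallyEq h
  have h3 := (hasDerivAt_deriv_log_Gamma (add_pos hx one_pos)).comp_add_const x 1
  rw [h3.unique h2]
  ring

theorem trigamma_nonneg {x : ℝ} (hx : 0 < x) : 0 ≤ trigamma x := by
  have hm : MonotoneOn (deriv fun y => Real.log (Real.Gamma y)) (Ioi 0) :=
    Real.convexOn_log_Gamma.monotoneOn_deriv fun y hy =>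
      (Real.analyticAt_log_Gamma hy).differentiableAt
  rw [← (hasDerivAt_deriv_log_Gamma hx).hasDerivWithinAt.derivWithin
    (isOpen_Ioi.uniqueDiffWithinAt (mem_Ioi.2 hx))]
  exact hm.derivWithin_nonneg

theorem tsum_one_div_add_sq_le_trigamma {x : ℝ} (hx : 0 < x) :
    ∑' n : ℕ, 1 / (x + n) ^ 2 ≤ trigamma x := by
  have h (n : ℕ) :
      trigamma x = ∑ k ∈ Finset.range n, 1 / (x + k) ^ 2 + trigamma (x + n) := by
    induction n with
    | zero => simp
    | succ n ih =>
      rw [ih, Finset.sum_range_succ, trigamma_eq_add_trigamma_add_one (by positivity : 0 < x + n)]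
      push_cast
      ring_nf
  refine (summable_one_div_add_natCast_sq hx).tsum_le_of_sum_range_le fun n => ?_
  linarith [h n, trigamma_nonneg (by positivity : 0 < x + n)]

/-- The digamma series, without its constant term. -/
noncomputable def digammaSeries (x : ℝ) : ℝ := ∑' n : ℕ, (1 / (1 + n : ℝ) - 1 / (x + n))

theorem hasDerivAt_one_div_sub_one_div_add (n : ℕ) {x : ℝ} (hx : 0 < x) :
    HasDerivAt (fun y : ℝ => 1 / (1 + n : ℝ) - 1 / (y + n)) (1 / (x + n) ^ 2) x := by
  have h := (((hasDerivAt_id x).add_const (n : ℝ)).inv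
    (by simp only [id]; positivity)).const_sub (1 / (1 + n : ℝ))
  simpa [neg_div] using h

theorem norm_one_div_add_natCast_sq_le (n : ℕ) {a x : ℝ} (ha : 0 < a) (hx : a ≤ x) :
    ‖1 / (x + n) ^ 2‖ ≤ 1 / (a + n) ^ 2 := by
  rw [Real.norm_of_nonneg (by positivity)]
  gcongr

theorem hasDerivAt_digammaSeries {x : ℝ} (hx : 0 < x) :
    HasDerivAt digammaSeries (∑' n : ℕ, 1 / (x + n) ^ 2) x := by
  have ha : 0 < min x 1 / 2 := by positivity
  exact hasDerivAt_tsum_of_isPreconnected (y₀ := 1) (summable_one_div_add_natCast_sq ha) isOpen_Ioi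
    isPreconnected_Ioi (fun n y hy => hasDerivAt_one_div_sub_one_div_add n (ha.trans hy))
    (fun n y hy => norm_one_div_add_natCast_sq_le n ha (le_of_lt hy))
    (mem_Ioi.2 (by linarith [min_le_right x 1])) (by simp)
    (mem_Ioi.2 (by linarith [min_le_left x 1]))

theorem summable_one_div_sub_one_div_add {x : ℝ} (hx : 0 < x) :
    Summable fun n : ℕ => 1 / (1 + n : ℝ) - 1 / (x + n) := by
  have ha : 0 < min x 1 / 2 := by positivity
  exact summable_of_summable_hasDerivAt_of_isPreconnected (y₀ := 1)
    (g := fun (n : ℕ) (y : ℝ) => 1 / (1 + n : ℝ) - 1 / (y + n))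
    (summable_one_div_add_natCast_sq ha) isOpen_Ioi
    isPreconnected_Ioi (fun n y hy => hasDerivAt_one_div_sub_one_div_add n (ha.trans hy))
    (fun n y hy => norm_one_div_add_natCast_sq_le n ha (le_of_lt hy))
    (mem_Ioi.2 (by linarith [min_le_right x 1])) (by simp)
    (mem_Ioi.2 (by linarith [min_le_left x 1]))

theorem digammaSeries_add_one {x : ℝ} (hx : 0 < x) :
    digammaSeries (x + 1) = digammaSeries x + 1 / x := by
  have h := (summable_one_div_sub_one_div_add hx).hasSum.add (hasSum_one_div_add_sub_one_div_add hx)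
  rw [digammaSeries, digammaSeries, ← h.tsum_eq]
  congr with n
  ring

theorem HasDerivAt.eq_zero_of_monotoneOn_of_periodic {f : ℝ → ℝ} {f' x : ℝ}
    (hd : HasDerivAt f f' x) (hx : 0 < x) (hm : MonotoneOn f (Ioi 0))
    (hp : ∀ y, 0 < y → f (y + 1) = f y) : f' = 0 := by
  have h : f =ᶠ[𝓝 x] fun _ => f x := by
    filter_upwards [lt_mem_nhds hx, Ioo_mem_nhds (sub_one_lt x) (lt_add_one x)] with y hy hxy
    have hx1 : 0 < x + 1 := by positivity
    have hy1 : 0 < y + 1 := by positivity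
    rcases le_total y x with hle | hle
    · exact le_antisymm (hm hy hx hle) (hp y hy ▸ hm hx hy1 (by linarith [hxy.1]))
    · exact le_antisymm (hp x hx ▸ hm hy hx1 hxy.2.le) (hm hx hy hle)
  exact hd.unique ((hasDerivAt_const x (f x)).congr_of_eventuallyEq h)

theorem trigamma_eq_tsum {x : ℝ} (hx : 0 < x) : trigamma x = ∑' n : ℕ, 1 / (x + n) ^ 2 := by
  have hd (y : ℝ) (hy : 0 < y) :=
    (hasDerivAt_deriv_log_Gamma hy).sub (hasDerivAt_digammaSeries hy)
  refine sub_eq_zero.1 ((hd x hx).eq_zero_of_monotoneOn_of_periodic hx ?_ fun y hy => ?_)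
  · refine monotoneOn_of_deriv_nonneg (convex_Ioi 0)
      (fun y hy => (hd y hy).continuousAt.continuousWithinAt) ?_ ?_ <;>
      rw [interior_Ioi]
    · exact fun y hy => (hd y hy).differentiableAt.differentiableWithinAt
    · intro y hy
      rw [(hd y hy).deriv]
      exact sub_nonneg.2 (tsum_one_div_add_sq_le_trigamma hy)
  · simp only [Pi.sub_apply, Real.deriv_log_Gamma_add_one hy, digammaSeries_add_one hy]
    ring

/-- **Trigamma bounds**: for every real `z ≥ 1`,
`1/z < ψ'(z) < 1/z + 1/(2z²) + 1/(6z³)`. -/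
theorem trigamma_bounds (z : ℝ) (hz : 1 ≤ z) :
    1 / z < trigamma z ∧ trigamma z < 1 / z + 1 / (2 * z ^ 2) + 1 / (6 * z ^ 3) := by
  have hz0 : 0 < z := by linarith
  rw [trigamma_eq_tsum hz0]
  exact ⟨one_div_lt_tsum_one_div_add_sq hz0, tsum_one_div_add_sq_lt hz0⟩
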